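/- Let R be a commutative ring, let j, t, m, n be integers with 1 ≤ j ≤ t ≤ m ≤ n, and let X be an m×n matrix over R written in block form X = [[U, V], [W, Z]], where U is a j×j matrix, V is j×(n−j), W is (m−j)×j, and Z is (m−j)×(n−j). If U is invertible, then I_t(X) = I_{t−j}(Z − W·U^{−1}·V) as ideals of R. -/

import Mathlib

open Matrix

/-- The ideal generated by the `t × t` minors of a matrix. -/
noncomputable def minorsIdeal {R : Type*} [CommRing R] {α β : Type*}
    (t : ℕ) (A : Matrix α β R) : Ideal R :=
  Ideal.span {d : R | ∃ (f : Fin t → α) (g : Fin t → β),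
    Function.Injective f ∧ Function.Injective g ∧ d = (A.submatrix f g).det}

/-- The height of an ideal: the infimum of the heights of primes containing it. -/
noncomputable def idealHeight {R : Type*} [CommRing R] (I : Ideal R) : ℕ∞ :=
  ⨅ p ∈ {p : PrimeSpectrum R | I ≤ p.asIdeal}, Order.height p

/-- The minimal number of generators of an ideal. -/
noncomputable def mu {R : Type*} [CommRing R] (I : Ideal R) : ℕ :=
  sInf {n : ℕ | ∃ s : Finset R, s.card = n ∧ Ideal.span (s : Set R) = I}

/-- The condition `G_s`. -/
def SatisfiesG {R : Type*} [CommRing R] (I : Ideal R) (s : ℕ) : Prop :=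
  ∀ (p : Ideal R) (hp : p.IsPrime), I ≤ p →
    haveI := hp
    ringKrullDim (Localization.AtPrime p) ≤ ((s - 1 : ℕ) : WithBot ℕ∞) →
    (mu (I.map (algebraMap R (Localization.AtPrime p))) : WithBot ℕ∞) ≤
      ringKrullDim (Localization.AtPrime p)

section MinorsIdeal

variable {R : Type*} [CommRing R] {α β γ : Type*}

theorem det_submatrix_mem_minorsIdeal {t : ℕ} (A : Matrix α β R) (f : Fin t → α)
    (g : Fin t → β) : (A.submatrix f g).det ∈ minorsIdeal t A := by
  by_cases hf : Function.Injective f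
  · by_cases hg : Function.Injective g
    · exact Ideal.subset_span ⟨f, g, hf, hg, rfl⟩
    · simp only [Function.Injective, not_forall] at hg
      obtain ⟨a, b, hab, hne⟩ := hg
      rw [Matrix.det_zero_of_column_eq hne fun i => by simp [hab]]
      exact Ideal.zero_mem _
  · simp only [Function.Injective, not_forall] at hf
    obtain ⟨a, b, hab, hne⟩ := hf
    rw [Matrix.det_zero_of_row_eq hne (by ext i; simp [hab])]
    exact Ideal.zero_mem _

/-- Left multiplication does not enlarge the ideals of minors. -/
theorem minorsIdeal_mul_le [Fintype β] (t : ℕ) (A : Matrix α β R) (B : Matrix β γ R) :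
    minorsIdeal t (A * B) ≤ minorsIdeal t B := by
  classical
  refine Ideal.span_le.2 ?_
  rintro _ ⟨f, g, -, -, rfl⟩
  have hrows : (A * B).submatrix f g = fun i => ∑ k, A (f i) k • fun c => B k (g c) := by
    ext i c
    simp [Matrix.mul_apply, Finset.sum_apply]
  change Matrix.detRowAlternating.toMultilinearMap ((A * B).submatrix f g) ∈ _
  rw [hrows, MultilinearMap.map_sum]
  refine Ideal.sum_mem _ fun r _ => ?_
  rw [MultilinearMap.map_smul_univ]
  exact Ideal.mul_mem_left _ _ (det_submatrix_mem_minorsIdeal B r g)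

/-- Laplace expansion along at most `k` rows indexed by the left summand, leaving minors of
order `s` supported on rows indexed by the right summand. -/
theorem det_submatrix_mem_of_minors_inr_mem (A : Matrix (α ⊕ β) γ R) (J : Ideal R) (s : ℕ)
    (hJ : ∀ (f : Fin s → β) (g : Fin s → γ), (A.submatrix (Sum.inr ∘ f) g).det ∈ J) (k : ℕ)
    (f : Fin (s + k) → α ⊕ β) (g : Fin (s + k) → γ)
    (hf : ∑ i, (if (f i).isLeft then 1 else 0) ≤ k) : (A.submatrix f g).det ∈ J := by
  induction k with
  | zero =>
    have hright : ∀ i, ∃ b, f i = Sum.inr b := fun i => by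
      have := Finset.sum_eq_zero_iff.1 (Nat.le_zero.1 hf) i (Finset.mem_univ i)
      cases h : f i <;> simp_all
    choose rows hrows using hright
    obtain rfl : f = Sum.inr ∘ rows := funext hrows
    exact hJ rows g
  | succ k ih =>
    obtain ⟨i, hi⟩ : ∃ i : Fin (s + k + 1),
        ∑ l, (if (f (i.succAbove l)).isLeft then 1 else 0) ≤ k := by
      by_cases h : ∃ i, (f i).isLeft
      · obtain ⟨i, hi⟩ := h
        refine ⟨i, ?_⟩
        have hsum := Fin.sum_univ_succAbove (fun l => if (f l).isLeft then 1 else 0) i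
        rw [if_pos hi] at hsum
        exact Nat.le_of_add_le_add_left ((hsum.symm.trans_le hf).trans_eq (Nat.add_comm k 1))
      · refine ⟨0, ?_⟩
        rw [Finset.sum_eq_zero fun l _ => if_neg fun hl => h ⟨_, hl⟩]
        exact Nat.zero_le k
    rw [Matrix.det_succ_row (n := s + k) (A.submatrix f g) i]
    refine Ideal.sum_mem _ fun c _ => Ideal.mul_mem_left _ _ ?_
    exact ih (f ∘ i.succAbove) (g ∘ c.succAbove) hi

theorem sum_isLeft_le_card [Fintype α] {t : ℕ} (f : Fin t → α ⊕ β)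
    (hf : Function.Injective f) :
    ∑ i, (if (f i).isLeft then 1 else 0) ≤ Fintype.card α := by
  classical
  rw [← Finset.card_filter]
  calc _ = ((Finset.univ.filter fun i => (f i).isLeft).image f).card :=
        (Finset.card_image_of_injective _ hf).symm
    _ ≤ (Finset.univ.image (Sum.inl : α → α ⊕ β)).card := by
        refine Finset.card_le_card fun x hx => ?_
        obtain ⟨i, hi, rfl⟩ := Finset.mem_image.1 hx
        obtain ⟨a, ha⟩ := Sum.isLeft_iff.1 (Finset.mem_filter.1 hi).2
        exact Finset.mem_image.2 ⟨a, Finset.mem_univ a, ha.symm⟩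
    _ ≤ _ := Finset.card_image_le

theorem minorsIdeal_fromBlocks_zero₂₁_le {δ : Type*} [Fintype α] (s : ℕ) (U : Matrix α γ R)
    (V : Matrix α δ R) (S : Matrix β δ R) :
    minorsIdeal (s + Fintype.card α) (Matrix.fromBlocks U V 0 S) ≤ minorsIdeal s S := by
  refine Ideal.span_le.2 ?_
  rintro _ ⟨f, g, hf, -, rfl⟩
  refine det_submatrix_mem_of_minors_inr_mem _ _ s (fun f g => ?_) _ f g (sum_isLeft_le_card f hf)
  by_cases h : ∃ c a, g c = Sum.inl a
  · obtain ⟨c, a, hc⟩ := h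
    rw [Matrix.det_eq_zero_of_column_eq_zero c fun i => by simp [hc]]
    exact Ideal.zero_mem _
  · have hright : ∀ c, ∃ b, g c = Sum.inr b := fun c => by
      cases hc : g c with
      | inl a => exact (h ⟨c, a, hc⟩).elim
      | inr b => exact ⟨b, rfl⟩
    choose cols hcols using hright
    obtain rfl : g = Sum.inr ∘ cols := funext hcols
    exact det_submatrix_mem_minorsIdeal S f cols

/-- Minors of the Schur complement are, up to a unit, minors of the whole block matrix. -/
theorem minorsIdeal_schur_le {j : ℕ} (s : ℕ) (U : Matrix (Fin j) (Fin j) R)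
    (V : Matrix (Fin j) β R) (W : Matrix α (Fin j) R) (Z : Matrix α β R) (hU : IsUnit U.det) :
    minorsIdeal s (Z - W * U⁻¹ * V) ≤ minorsIdeal (s + j) (Matrix.fromBlocks U V W Z) := by
  refine Ideal.span_le.2 ?_
  rintro _ ⟨f, g, -, -, rfl⟩
  let e : Fin (s + j) ≃ Fin j ⊕ Fin s := finSumFinEquiv.symm.trans (Equiv.sumComm _ _)
  have hmem := det_submatrix_mem_minorsIdeal (Matrix.fromBlocks U V W Z)
    (Sum.map id f ∘ e) (Sum.map id g ∘ e)
  have hblocks : (Matrix.fromBlocks U V W Z).submatrix (Sum.map id f) (Sum.map id g) =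
      Matrix.fromBlocks U (V.submatrix id g) (W.submatrix f id) (Z.submatrix f g) := by
    ext (i | i) (k | k) <;> rfl
  let _ := U.invertibleOfIsUnitDet hU
  rw [← Matrix.submatrix_submatrix, Matrix.det_submatrix_equiv_self, hblocks,
    Matrix.det_fromBlocks₁₁, Matrix.invOf_eq_nonsing_inv] at hmem
  exact (Ideal.unit_mul_mem_iff_mem _ hU).1 hmem

theorem minorsIdeal_fromBlocks_le {j : ℕ} [Fintype α] [DecidableEq α] (s : ℕ)
    (U : Matrix (Fin j) (Fin j) R) (V : Matrix (Fin j) β R) (W : Matrix α (Fin j) R)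
    (Z : Matrix α β R) (hU : IsUnit U.det) :
    minorsIdeal (s + j) (Matrix.fromBlocks U V W Z) ≤ minorsIdeal s (Z - W * U⁻¹ * V) := by
  have hfactor : Matrix.fromBlocks U V W Z =
      (Matrix.fromBlocks 1 0 (W * U⁻¹) 1 : Matrix (Fin j ⊕ α) (Fin j ⊕ α) R) *
        (Matrix.fromBlocks U V 0 (Z - W * U⁻¹ * V) : Matrix (Fin j ⊕ α) (Fin j ⊕ β) R) := by
    rw [Matrix.fromBlocks_multiply]
    simp [Matrix.mul_assoc, Matrix.nonsing_inv_mul U hU]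
  rw [hfactor]
  refine (minorsIdeal_mul_le _ _ _).trans ?_
  simpa using minorsIdeal_fromBlocks_zero₂₁_le s U V (Z - W * U⁻¹ * V)

end MinorsIdeal

theorem statement_12 {R : Type*} [CommRing R]
    (j t m n : ℕ) (h1j : 1 ≤ j) (hjt : j ≤ t) (htm : t ≤ m) (hmn : m ≤ n)
    (U : Matrix (Fin j) (Fin j) R) (V : Matrix (Fin j) (Fin (n - j)) R)
    (W : Matrix (Fin (m - j)) (Fin j) R) (Z : Matrix (Fin (m - j)) (Fin (n - j)) R)
    (hU : IsUnit U.det) :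
    minorsIdeal t (Matrix.fromBlocks U V W Z) = minorsIdeal (t - j) (Z - W * U⁻¹ * V) := by
  obtain ⟨s, rfl⟩ := Nat.exists_eq_add_of_le' hjt
  rw [Nat.add_sub_cancel]
  exact le_antisymm (minorsIdeal_fromBlocks_le s U V W Z hU) (minorsIdeal_schur_le s U V W Z hU)
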